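/- arXiv:1908.11533 — 4 statements merged into one kernel-verified Lean document; each statement's English description precedes it below -/
import Mathlib

section
/- Let h > 0, ε > 0, and w ∈ ℝᴺ with wⁱ ≥ 0 for all i and Σ_i wⁱ ≥ 1. If ψ ∈ ℝᴺ satisfies w_{h,ε}(ψ) = w, then the pair (T_ψ, G(ψ)) is the unique minimizer of the optimal transport problem with storage fee F_{w,h,ε}: for every β̃ ∈ ℝᴺ and every measurable T̃ : X → Y with T̃_#μ = Σ_i β̃ⁱ δ_{y_i}, one has ∫_X c(x, T_ψ(x)) dμ + F_{w,h,ε}(G(ψ)) ≤ ∫_X c(x, T̃(x)) dμ + F_{w,h,ε}(β̃), with equality only if β̃ = G(ψ) and T̃ = T_ψ μ-a.e. -/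
open MeasureTheory Metric Set Filter
open scoped Classical

noncomputable section

abbrev Pt (n : ℕ) := EuclideanSpace ℝ (Fin n)

/-- The function `g(t) = 2(1 + t² − t√(1+t²))`. -/
def gfun (t : ℝ) : ℝ := 2 * (1 + t ^ 2 - t * Real.sqrt (1 + t ^ 2))

variable {n N : ℕ}

/-- The `i`-th Laguerre cell associated to `ψ`. -/
def LagCell (X : Set (Pt n)) (c : Pt n → Fin N → ℝ) (ψ : Fin N → ℝ) (i : Fin N) :
    Set (Pt n) :=
  {x ∈ X | -c x i - ψ i = ⨆ j, (-c x j - ψ j)}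

/-- `G(ψ) = (μ(Lag_1(ψ)),…,μ(Lag_N(ψ)))`. -/
def Gfun (X : Set (Pt n)) (c : Pt n → Fin N → ℝ) (μ : Measure (Pt n)) (ψ : Fin N → ℝ)
    (i : Fin N) : ℝ := (μ (LagCell X c ψ i)).toReal

/-- `𝒦^ε = {ψ : Gⁱ(ψ) > ε for all i}`. -/
def Kset (X : Set (Pt n)) (c : Pt n → Fin N → ℝ) (μ : Measure (Pt n)) (ε : ℝ) :
    Set (Fin N → ℝ) := {ψ | ∀ i, ε < Gfun X c μ ψ i}

/-- `wⁱ_{h,ε}(ψ) = (Gⁱ(ψ) − ε)·g(ψⁱ/h)`. -/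
def wmap (X : Set (Pt n)) (c : Pt n → Fin N → ℝ) (μ : Measure (Pt n)) (h ε : ℝ)
    (ψ : Fin N → ℝ) : Fin N → ℝ := fun i => (Gfun X c μ ψ i - ε) * gfun (ψ i / h)

/-- `𝒩_{w,h,ε} = {ψ ∈ 𝒦^ε : Σ wⁱ = Σ wⁱ_{h,ε}(ψ)}`. -/
def Nset (X : Set (Pt n)) (c : Pt n → Fin N → ℝ) (μ : Measure (Pt n)) (h ε : ℝ)
    (w : Fin N → ℝ) : Set (Fin N → ℝ) :=
  {ψ ∈ Kset X c μ ε | ∑ i, w i = ∑ i, wmap X c μ h ε ψ i}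

/-- `𝒲^{ε₀} = {ψ : wⁱ_{h,ε}(ψ) ≥ ε₀ for all i}`. -/
def Wset (X : Set (Pt n)) (c : Pt n → Fin N → ℝ) (μ : Measure (Pt n)) (h ε ε₀ : ℝ) :
    Set (Fin N → ℝ) := {ψ | ∀ i, ε₀ ≤ wmap X c μ h ε ψ i}

/-- Euclidean (ℓ²) norm on `ℝᴺ`. -/
def eNorm2 (v : Fin N → ℝ) : ℝ := Real.sqrt (∑ i, v i ^ 2)

/-- ℓ¹ norm on `ℝᴺ`. -/
def l1Norm (v : Fin N → ℝ) : ℝ := ∑ i, |v i|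

/-- `T_#μ = Σ βⁱ δ_{y_i}`, with target points recorded by their indices. -/
def IsPush (μ : Measure (Pt n)) (T : Pt n → Fin N) (β : Fin N → ℝ) : Prop :=
  ∀ i, μ (T ⁻¹' {i}) = ENNReal.ofReal (β i)

/-- `(T,β)` minimizes the optimal transport problem with storage fee `F`. -/
def MinimizesStorage (c : Pt n → Fin N → ℝ) (μ : Measure (Pt n))
    (F : (Fin N → ℝ) → EReal) (T : Pt n → Fin N) (β : Fin N → ℝ) : Prop :=
  Measurable T ∧ IsPush μ T β ∧
    ∀ (T' : Pt n → Fin N) (β' : Fin N → ℝ), Measurable T' → IsPush μ T' β' →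
      ((∫ x, c x (T x) ∂μ : ℝ) : EReal) + F β ≤ ((∫ x, c x (T' x) ∂μ : ℝ) : EReal) + F β'

/-- The storage fee `F_w`: indicator of the box `Π [0, wⁱ]`. -/
def Fw (w β : Fin N → ℝ) : EReal := if ∀ i, β i ∈ Icc 0 (w i) then 0 else ⊤

/-- The standard simplex `Δ_N`. -/
def simplexSet (N : ℕ) : Set (Fin N → ℝ) := {β | ∑ i, β i = 1 ∧ ∀ i, 0 ≤ β i}

/-- The smoothed storage fee `F_{w,h,ε}`. -/
def Fwhe (w : Fin N → ℝ) (h ε : ℝ) (β : Fin N → ℝ) : EReal :=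
  if β ∈ simplexSet N ∧ ∀ i, β i ∈ Icc ε (w i + ε) then
    (((-h) * ∑ i, Real.sqrt ((β i - ε) * (w i - β i + ε)) : ℝ) : EReal)
  else ⊤

/-- (Reg): each `c(·,y_i)` is `C²` on `X`. -/
def RegCond (X : Set (Pt n)) (c : Pt n → Fin N → ℝ) : Prop :=
  ∀ i, ContDiffOn ℝ 2 (fun x => c x i) X

/-- (Twist): the gradients `∇_x c(x,y_i)` are pairwise distinct. -/
def TwistCond (X : Set (Pt n)) (c : Pt n → Fin N → ℝ) : Prop :=
  ∀ x ∈ X, ∀ i k : Fin N, i ≠ k →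
    fderivWithin ℝ (fun y => c y i) X x ≠ fderivWithin ℝ (fun y => c y k) X x

/-- Loeper's condition (QC), together with `c`-convexity of `X` with respect to `Y`. -/
def LoeperCond (X : Set (Pt n)) (c : Pt n → Fin N → ℝ) : Prop :=
  ∃ (Xi : Fin N → Set (Pt n)) (expc iexpc : Fin N → Pt n → Pt n),
    ∀ i, Convex ℝ (Xi i) ∧ ContDiffOn ℝ 2 (expc i) (Xi i) ∧
      ContDiffOn ℝ 2 (iexpc i) X ∧ Set.BijOn (expc i) (Xi i) X ∧
      Set.InvOn (iexpc i) (expc i) (Xi i) X ∧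
      ∀ (t : ℝ) (k : Fin N), Convex ℝ {p ∈ Xi i | -c (expc i p) k + c (expc i p) i ≤ t}

/-- `μ = ρ dx` for a `C^{0,α}` density `ρ`. -/
def HolderDensity (X : Set (Pt n)) (μ : Measure (Pt n)) (α : ℝ) : Prop :=
  ∃ ρ : Pt n → ℝ, μ = volume.withDensity (fun x => ENNReal.ofReal (ρ x)) ∧
    ContinuousOn ρ X ∧ ∃ Cρ : ℝ, ∀ x ∈ X, ∀ y ∈ X, |ρ x - ρ y| ≤ Cρ * ‖x - y‖ ^ α

/-- `(q,1)`-Poincaré–Wirtinger inequality with constant `CPW`. -/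
def PWineq (μ : Measure (Pt n)) (q CPW : ℝ) : Prop :=
  ∀ f : Pt n → ℝ, ContDiff ℝ 1 f →
    (∫ x, |f x - ∫ y, f y ∂μ| ^ q ∂μ) ^ (1 / q) ≤ CPW * ∫ x, ‖fderiv ℝ f x‖ ∂μ

/-- `T` agrees `μ`-a.e. with the Laguerre-cell map `T_ψ`. -/
def AgreesAE (X : Set (Pt n)) (c : Pt n → Fin N → ℝ) (μ : Measure (Pt n))
    (ψ : Fin N → ℝ) (T : Pt n → Fin N) : Prop :=
  ∀ᵐ x ∂μ, x ∈ LagCell X c ψ (T x)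

/-- The Kantorovich transport-cost functional `𝒞`. -/
def Cfun (c : Pt n → Fin N → ℝ) (μ : Measure (Pt n)) (β : Fin N → ℝ) : ℝ :=
  ⨆ ψ : Fin N → ℝ, (-(∫ x, (⨆ i, (-c x i - ψ i)) ∂μ) - ∑ i, ψ i * β i)

/-- One step of the damped Newton algorithm with parameters `h, ε, ε₀, w`. -/
def NewtonIter (X : Set (Pt n)) (c : Pt n → Fin N → ℝ) (μ : Measure (Pt n))
    (h ε ε₀ : ℝ) (w : Fin N → ℝ) (ψ ψ' : Fin N → ℝ) : Prop :=
  ∃ A : (Fin N → ℝ) ≃L[ℝ] (Fin N → ℝ),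
    (A : (Fin N → ℝ) →L[ℝ] (Fin N → ℝ)) = fderiv ℝ (wmap X c μ h ε) ψ ∧
    ∃ (ℓ : ℕ) (r : ℝ),
      ψ' = ψ - ((2 : ℝ)⁻¹ ^ ℓ) • A.symm (wmap X c μ h ε ψ - w) + r • (fun _ => (1 : ℝ)) ∧
      ψ' ∈ Nset X c μ h ε w ∧ (∀ i, ε₀ ≤ wmap X c μ h ε ψ' i) ∧
      eNorm2 (wmap X c μ h ε ψ' - w) ≤
        (1 - (2 : ℝ)⁻¹ ^ (ℓ + 1)) * eNorm2 (wmap X c μ h ε ψ - w) ∧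
      ∀ ℓ' < ℓ, ∀ r' : ℝ,
        (ψ - ((2 : ℝ)⁻¹ ^ ℓ') • A.symm (wmap X c μ h ε ψ - w) + r' • (fun _ => (1 : ℝ)))
          ∈ Nset X c μ h ε w →
        ¬((∀ i, ε₀ ≤ wmap X c μ h ε
              (ψ - ((2 : ℝ)⁻¹ ^ ℓ') • A.symm (wmap X c μ h ε ψ - w)
                + r' • (fun _ => (1 : ℝ))) i) ∧
          eNorm2 (wmap X c μ h ε
              (ψ - ((2 : ℝ)⁻¹ ^ ℓ') • A.symm (wmap X c μ h ε ψ - w)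
                + r' • (fun _ => (1 : ℝ))) - w) ≤
            (1 - (2 : ℝ)⁻¹ ^ (ℓ' + 1)) * eNorm2 (wmap X c μ h ε ψ - w))



theorem aux_g (t : ℝ) : ∃ a : ℝ, 0 < a ∧ gfun t = 1 + a ^ 2 ∧ 2 * a * t = 1 - a ^ 2 := by
  have hs : Real.sqrt (1 + t ^ 2) ^ 2 = 1 + t ^ 2 := Real.sq_sqrt (by positivity)
  have hlt : t < Real.sqrt (1 + t ^ 2) := by
    apply Real.lt_sqrt_of_sq_lt
    linarith
  refine ⟨Real.sqrt (1 + t ^ 2) - t, by linarith, ?_, ?_⟩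
  · unfold gfun; nlinarith
  · nlinarith

theorem aux_box {G ε t w : ℝ} (hg : (G - ε) * gfun t = w) (hw : 0 ≤ w) :
    G ∈ Icc ε (w + ε) := by
  obtain ⟨a, ha, hga, -⟩ := aux_g t
  rw [hga] at hg
  have h1 : 0 ≤ G - ε := by
    by_contra hc
    push Not at hc
    have : 0 < 1 + a ^ 2 := by positivity
    nlinarith
  constructor
  · linarith
  · nlinarith [mul_nonneg h1 (sq_nonneg a)]

theorem aux_sub {G ε ψ w h b : ℝ} (hh : 0 < h) (hg : (G - ε) * gfun (ψ / h) = w)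
    (hG : G ∈ Icc ε (w + ε)) (hb : b ∈ Icc ε (w + ε)) :
    (-h) * Real.sqrt ((G - ε) * (w - G + ε)) + (ψ * b - ψ * G)
      ≤ (-h) * Real.sqrt ((b - ε) * (w - b + ε)) := by
  obtain ⟨a, ha, hga, hat⟩ := aux_g (ψ / h)
  obtain ⟨t, rfl⟩ : ∃ t, ψ = h * t := ⟨ψ / h, by field_simp⟩
  have ht : h * t / h = t := by field_simp
  rw [ht] at hga hat hg
  rw [hga] at hg
  obtain ⟨u, rfl⟩ : ∃ u, G = u + ε := ⟨G - ε, by ring⟩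
  obtain ⟨v, rfl⟩ : ∃ v, b = v + ε := ⟨b - ε, by ring⟩
  have hu : 0 ≤ u := by linarith [hG.1]
  have hv : 0 ≤ v := by linarith [hb.1]
  have hvw : v ≤ w := by linarith [hb.2]
  have e1 : Real.sqrt ((u + ε - ε) * (w - (u + ε) + ε)) = u * a := by
    rw [← Real.sqrt_sq (mul_nonneg hu ha.le)]
    congr 1
    rw [← hg]; ring
  have e2 : Real.sqrt ((v + ε - ε) * (w - (v + ε) + ε)) ≤ u * a - t * (v - u) := by
    have e3 : u * a - t * (v - u) = (a ^ 2 * v + (w - v)) / (2 * a) := by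
      rw [eq_div_iff (by positivity), ← hg]
      linear_combination (u - v) * hat
    rw [e3]
    have : 0 ≤ w - v := by linarith
    apply Real.sqrt_le_iff.2
    refine ⟨by positivity, ?_⟩
    rw [div_pow, le_div_iff₀ (by positivity)]
    nlinarith [sq_nonneg (a ^ 2 * v - (w - v))]
  rw [e1]
  nlinarith [mul_le_mul_of_nonneg_left e2 hh.le]

theorem aux_integrable {n N : ℕ} {c : Pt n → Fin N → ℝ} {μ : Measure (Pt n)}
    (hint : ∀ i, Integrable (fun x => c x i) μ) {T : Pt n → Fin N} (hT : Measurable T) :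
    Integrable (fun x => c x (T x)) μ := by
  have : (fun x => c x (T x)) = fun x => ∑ i, (T ⁻¹' {i}).indicator (fun x => c x i) x := by
    funext x
    rw [Finset.sum_eq_single (T x)]
    · simp
    · intro b _ hb
      apply indicator_of_notMem
      intro hx
      exact hb hx.symm
    · simp
  rw [this]
  exact integrable_finsetSum _ fun i _ =>
    (hint i).indicator (hT (measurableSet_singleton i))

theorem aux_int {n N : ℕ} {μ : Measure (Pt n)} [IsProbabilityMeasure μ]
    {T : Pt n → Fin N} {β : Fin N → ℝ} (hT : Measurable T) (hP : IsPush μ T β)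
    (hβ : ∀ i, 0 ≤ β i) (ψ : Fin N → ℝ) :
    ∫ x, ψ (T x) ∂μ = ∑ i, ψ i * β i := by
  have : (fun x => ψ (T x)) = fun x => ∑ i, (T ⁻¹' {i}).indicator (fun _ => ψ i) x := by
    funext x
    rw [Finset.sum_eq_single (T x)]
    · simp
    · intro b _ hb
      apply indicator_of_notMem
      intro hx
      exact hb hx.symm
    · simp
  rw [this, integral_finsetSum _ fun i _ =>
    (integrable_const _).indicator (hT (measurableSet_singleton i))]
  refine Finset.sum_congr rfl fun i _ => ?_
  rw [integral_indicator_const _ (hT (measurableSet_singleton i)), measureReal_def, hP i,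
    ENNReal.toReal_ofReal (hβ i), smul_eq_mul, mul_comm]

theorem aux_meas {n N : ℕ} {X : Set (Pt n)} (hX : IsCompact X) {c : Pt n → Fin N → ℝ}
    (hci : ∀ i, ContinuousOn (fun x => c x i) X) (hN : 1 ≤ N) {ψ : Fin N → ℝ} (i : Fin N) :
    MeasurableSet (LagCell X c ψ i) := by
  have hne : Nonempty (Fin N) := ⟨i⟩
  have : LagCell X c ψ i = X ∩ ⋂ j, {x ∈ X | -c x j - ψ j ≤ -c x i - ψ i} := by
    ext x
    simp only [LagCell, mem_setOf_eq, mem_inter_iff, mem_iInter]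
    constructor
    · rintro ⟨hx, he⟩
      refine ⟨hx, fun j => ⟨hx, ?_⟩⟩
      rw [he]
      exact le_ciSup (f := fun j => -c x j - ψ j) (Set.finite_range _).bddAbove j
    · rintro ⟨hx, he⟩
      refine ⟨hx, le_antisymm ?_ ?_⟩
      · exact le_ciSup (f := fun j => -c x j - ψ j) (Set.finite_range _).bddAbove i
      · exact ciSup_le fun j => (he j).2
  rw [this]
  refine hX.isClosed.measurableSet.inter (MeasurableSet.iInter fun j => ?_)
  exact (IsClosed.isClosed_le hX.isClosed ((hci j).neg.sub continuousOn_const)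
    ((hci i).neg.sub continuousOn_const)).measurableSet

theorem aux_null {n : ℕ} {X : Set (Pt n)} (hX : IsCompact X) (hn : 0 < n)
    {f g : Pt n → ℝ} (hf : ContDiffOn ℝ 2 f X) (hg : ContDiffOn ℝ 2 g X)
    (hne : ∀ x ∈ X, fderivWithin ℝ f X x ≠ fderivWithin ℝ g X x) (t : ℝ) :
    volume {x ∈ X | f x - g x = t} = 0 := by
  set S : Set (Pt n) := {x ∈ X | f x - g x = t} with hS
  have hSm : MeasurableSet S := by
    have : IsClosed (X ∩ (fun x => f x - g x) ⁻¹' {t}) :=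
      (hf.continuousOn.sub hg.continuousOn).preimage_isClosed_of_isClosed hX.isClosed
        isClosed_singleton
    exact this.measurableSet
  let v : Pt n := EuclideanSpace.single ⟨0, hn⟩ 1
  have hv : v ≠ 0 := by
    intro h0
    have := congrArg (fun u : Pt n => u ⟨0, hn⟩) h0
    simp [v] at this
  let f' : Pt n → Pt n →L[ℝ] Pt n := fun x =>
    (fderivWithin ℝ f X x - fderivWithin ℝ g X x).smulRight v
  have happ : ApproximatesLinearOn (fun x => (f x - g x) • v) (0 : Pt n →L[ℝ] Pt n) S 0 := by
    intro x hx y hy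
    simp [hx.2, hy.2]
  have hd : ∀ x ∈ S, HasFDerivWithinAt (fun x => (f x - g x) • v) (f' x) S x := by
    intro x hx
    have h1 := ((hf.differentiableOn (by norm_num)) x hx.1).hasFDerivWithinAt
    have h2 := ((hg.differentiableOn (by norm_num)) x hx.1).hasFDerivWithinAt
    exact ((h1.sub h2).smul_const v).mono (fun y hy => hy.1)
  have hae := happ.norm_fderiv_sub_le volume hSm f' hd
  have : ∀ᵐ x ∂(volume.restrict S), False := by
    filter_upwards [hae, ae_restrict_mem hSm] with x hx hxS
    apply hne x hxS.1
    have h0 : f' x = 0 := by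
      have : ‖f' x - 0‖₊ = 0 := le_antisymm hx bot_le
      simpa using this
    rw [← sub_eq_zero]
    ext u
    have h1 := congrArg (fun L : Pt n →L[ℝ] Pt n => L u) h0
    simp only [f', ContinuousLinearMap.smulRight_apply] at h1
    rcases smul_eq_zero.1 h1 with h2 | h2
    · simpa using h2
    · exact absurd h2 hv
  rw [ae_iff] at this
  simpa using this

theorem stmt7
    (n N : ℕ) (hn : 2 ≤ n) (hN : 1 ≤ N)
    (X : Set (Pt n)) (hX : IsCompact X)
    (Y : Fin N → Pt n) (hY : Function.Injective Y)
    (c : Pt n → Fin N → ℝ) (hreg : RegCond X c) (htw : TwistCond X c)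
    (μ : Measure (Pt n)) (hprob : IsProbabilityMeasure μ)
    (hac : μ ≪ volume) (hsupp : μ Xᶜ = 0)
    (hqc : LoeperCond X c)
    (α : ℝ) (hα : 0 < α) (hα1 : α ≤ 1)
    (hdens : HolderDensity X μ α) :
    ∀ (h ε : ℝ) (w ψ : Fin N → ℝ),
      0 < h → 0 < ε → (∀ i, 0 ≤ w i) → 1 ≤ ∑ i, w i →
      wmap X c μ h ε ψ = w →
      ∃ T : Pt n → Fin N, Measurable T ∧ AgreesAE X c μ ψ T ∧
        MinimizesStorage c μ (Fwhe w h ε) T (Gfun X c μ ψ) ∧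
        ∀ (T' : Pt n → Fin N) (β' : Fin N → ℝ), Measurable T' → IsPush μ T' β' →
          ((∫ x, c x (T' x) ∂μ : ℝ) : EReal) + Fwhe w h ε β' =
            ((∫ x, c x (T x) ∂μ : ℝ) : EReal) + Fwhe w h ε (Gfun X c μ ψ) →
          β' = Gfun X c μ ψ ∧ T' =ᵐ[μ] T := by
  intro h ε w ψ hh hε hw hw1 hwm
  have hXm : MeasurableSet X := hX.isClosed.measurableSet
  have hXae : ∀ᵐ x ∂μ, x ∈ X := by
    rw [ae_iff]; exact hsupp
  have hres : μ.restrict X = μ := Measure.restrict_eq_self_of_ae_mem hXae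
  have hci : ∀ i, ContinuousOn (fun x => c x i) X := fun i => (hreg i).continuousOn
  have hint : ∀ i, Integrable (fun x => c x i) μ := by
    intro i
    have := (hci i).integrableOn_compact (μ := μ) hX
    rwa [IntegrableOn, hres] at this
  have hLm : ∀ i, MeasurableSet (LagCell X c ψ i) := aux_meas hX hci hN
  have hnull : ∀ᵐ x ∂μ, ∀ i k, x ∈ LagCell X c ψ i → x ∈ LagCell X c ψ k → i = k := by
    rw [ae_all_iff]; intro i
    rw [ae_all_iff]; intro k
    by_cases hik : i = k
    · exact Filter.Eventually.of_forall (fun _ _ _ => hik)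
    have h0 := hac (aux_null hX (by omega) (hreg i) (hreg k)
      (fun x hx => htw x hx i k hik) (ψ k - ψ i))
    have : ∀ᵐ x ∂μ, x ∉ {x ∈ X | c x i - c x k = ψ k - ψ i} := by
      rw [ae_iff]; simpa using h0
    filter_upwards [this] with x hx hi hk
    exfalso
    apply hx
    refine ⟨hi.1, ?_⟩
    have := hi.2.trans hk.2.symm
    linarith
  -- the map
  have hne : Nonempty (Fin N) := ⟨⟨0, hN⟩⟩
  let tf : ℕ → Fin N := fun k => if hk : k < N then ⟨k, hk⟩ else ⟨0, hN⟩
  have hp : ∀ x, ∃ k, x ∈ X → x ∈ LagCell X c ψ (tf k) := by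
    intro x
    obtain ⟨i, hi⟩ := exists_eq_ciSup_of_finite (f := fun j => -c x j - ψ j)
    refine ⟨i, fun hx => ?_⟩
    have : tf i = i := by simp [tf]
    rw [this]
    exact ⟨hx, hi⟩
  let T : Pt n → Fin N := fun x => tf (Nat.find (hp x))
  have hTm : Measurable T := by
    refine Measurable.comp (measurable_of_countable tf) (measurable_find hp ?_)
    intro k
    have : {x | x ∈ X → x ∈ LagCell X c ψ (tf k)} = Xᶜ ∪ LagCell X c ψ (tf k) := by
      ext x; simp [imp_iff_not_or]
    rw [this]
    exact hXm.compl.union (hLm _)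
  have hTL : ∀ᵐ x ∂μ, x ∈ LagCell X c ψ (T x) := by
    filter_upwards [hXae] with x hx
    exact Nat.find_spec (hp x) hx
  have hpush : ∀ i, μ (T ⁻¹' {i}) = μ (LagCell X c ψ i) := by
    intro i
    apply measure_congr
    filter_upwards [hTL, hnull] with x hx hn
    apply propext
    constructor
    · intro hxi
      have : T x = i := hxi
      rw [← this]; exact hx
    · intro hxi
      exact hn _ _ hx hxi
  have hTpush : IsPush μ T (Gfun X c μ ψ) := by
    intro i
    rw [hpush, Gfun, ENNReal.ofReal_toReal (measure_ne_top _ _)]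
  have hG0 : ∀ i, 0 ≤ Gfun X c μ ψ i := fun i => ENNReal.toReal_nonneg
  have hGsum : ∑ i, Gfun X c μ ψ i = 1 := by
    have := aux_int hTm hTpush hG0 (fun _ => 1)
    simpa using this.symm
  have hg : ∀ i, (Gfun X c μ ψ i - ε) * gfun (ψ i / h) = w i := fun i => congrFun hwm i
  have hbox : ∀ i, Gfun X c μ ψ i ∈ Icc ε (w i + ε) :=
    fun i => aux_box (hg i) (hw i)
  have hFG : Fwhe w h ε (Gfun X c μ ψ) = (((-h) * ∑ i, Real.sqrt ((Gfun X c μ ψ i - ε) *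
      (w i - Gfun X c μ ψ i + ε)) : ℝ) : EReal) := by
    rw [Fwhe, if_pos ⟨⟨hGsum, hG0⟩, hbox⟩]
  -- integrability
  have hcT : ∀ T' : Pt n → Fin N, Measurable T' → Integrable (fun x => c x (T' x)) μ :=
    fun T' hT' => aux_integrable hint hT'
  have hpT : ∀ T' : Pt n → Fin N, Measurable T' → Integrable (fun x => ψ (T' x)) μ :=
    fun T' hT' => aux_integrable (c := fun _ i => ψ i) (fun i => integrable_const _) hT'
  have hle : ∀ T' : Pt n → Fin N,
      ∀ᵐ x ∂μ, c x (T x) + ψ (T x) ≤ c x (T' x) + ψ (T' x) := by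
    intro T'
    filter_upwards [hTL] with x hx
    have := le_ciSup (f := fun j => -c x j - ψ j) (Set.finite_range _).bddAbove (T' x)
    have h2 := hx.2
    linarith
  have hIle : ∀ T' : Pt n → Fin N, Measurable T' →
      ∫ x, c x (T x) + ψ (T x) ∂μ ≤ ∫ x, c x (T' x) + ψ (T' x) ∂μ := fun T' hT' =>
    integral_mono_ae ((hcT T hTm).add (hpT T hTm)) ((hcT T' hT').add (hpT T' hT')) (hle T')
  have hTpsi := aux_int hTm hTpush hG0 ψ
  have hadd : ∀ T' : Pt n → Fin N, Measurable T' →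
      ∫ x, c x (T' x) + ψ (T' x) ∂μ = ∫ x, c x (T' x) ∂μ + ∫ x, ψ (T' x) ∂μ := fun T' hT' =>
    integral_add (hcT T' hT') (hpT T' hT')
  have hsub : ∀ β' : Fin N → ℝ, (∀ i, β' i ∈ Icc ε (w i + ε)) →
      (-h) * ∑ i, Real.sqrt ((Gfun X c μ ψ i - ε) * (w i - Gfun X c μ ψ i + ε))
        + (∑ i, ψ i * β' i - ∑ i, ψ i * Gfun X c μ ψ i)
      ≤ (-h) * ∑ i, Real.sqrt ((β' i - ε) * (w i - β' i + ε)) := by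
    intro β' hβ'
    rw [Finset.mul_sum, Finset.mul_sum, ← Finset.sum_sub_distrib, ← Finset.sum_add_distrib]
    refine Finset.sum_le_sum fun i _ => ?_
    exact aux_sub hh (hg i) (hbox i) (hβ' i)
  refine ⟨T, hTm, hTL, ⟨hTm, hTpush, ?_⟩, ?_⟩
  · intro T' β' hT' hP'
    by_cases hc : β' ∈ simplexSet N ∧ ∀ i, β' i ∈ Icc ε (w i + ε)
    · rw [hFG, Fwhe, if_pos hc, ← EReal.coe_add, ← EReal.coe_add, EReal.coe_le_coe_iff]
      have h1 := hIle T' hT'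
      rw [hadd T hTm, hadd T' hT', hTpsi, aux_int hT' hP' hc.1.2 ψ] at h1
      have h2 := hsub β' hc.2
      linarith
    · rw [Fwhe, Fwhe, if_neg hc, EReal.coe_add_top]
      exact le_top
  · intro T' β' hT' hP' heq
    by_cases hc : β' ∈ simplexSet N ∧ ∀ i, β' i ∈ Icc ε (w i + ε)
    · rw [hFG, Fwhe, if_pos hc, ← EReal.coe_add, ← EReal.coe_add, EReal.coe_eq_coe_iff] at heq
      have h1 := hIle T' hT'
      have h2 := hsub β' hc.2
      have h3 : ∫ x, c x (T x) + ψ (T x) ∂μ = ∫ x, c x (T' x) + ψ (T' x) ∂μ := by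
        rw [hadd T hTm, hadd T' hT', hTpsi, aux_int hT' hP' hc.1.2 ψ] at h1 ⊢
        linarith
      have h4 := (integral_eq_iff_of_ae_le ((hcT T hTm).add (hpT T hTm))
        ((hcT T' hT').add (hpT T' hT')) (hle T')).1 h3
      have h5 : T' =ᵐ[μ] T := by
        filter_upwards [h4, hTL, hnull] with x hx hxL hxn
        refine hxn _ _ ⟨hxL.1, ?_⟩ hxL
        rw [← hxL.2]
        simp only [Pi.add_apply] at hx
        linarith
      refine ⟨?_, h5⟩
      funext i
      have h6 : μ (T' ⁻¹' {i}) = μ (T ⁻¹' {i}) := by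
        apply measure_congr
        filter_upwards [h5] with x hx
        apply propext
        change T' x = i ↔ T x = i
        rw [hx]
      rw [hP' i, hTpush i] at h6
      exact (ENNReal.ofReal_eq_ofReal_iff (hc.1.2 i) (hG0 i)).1 h6
    · rw [hFG, Fwhe, if_neg hc, EReal.coe_add_top, ← EReal.coe_add] at heq
      exact absurd heq.symm (EReal.coe_ne_top _)
end
end

section
/- Let h > 0, ε > 0, and w ∈ ℝᴺ with wⁱ ≥ 0 for all i and Σ_i wⁱ ≥ 1. If ψ ∈ ℝᴺ satisfies w_{h,ε}(ψ) = w, then ψ belongs to the subdifferential of the convex function F_{w,h,ε} at the point G(ψ): for every β ∈ ℝᴺ, F_{w,h,ε}(β) ≥ F_{w,h,ε}(G(ψ)) + ⟨ψ, β − G(ψ)⟩, an inequality in ℝ ∪ {+∞} (in particular F_{w,h,ε}(G(ψ)) is finite). -/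
open MeasureTheory Metric Set Filter
open scoped Classical

noncomputable section

variable {n N : ℕ}

theorem coord_ineq (a b w t : ℝ) (hw : 0 ≤ w) (hwa : w = a * gfun t) (hb0 : 0 ≤ b)
    (hb : b ≤ w) :
    0 ≤ a ∧ a ≤ w ∧
      -Real.sqrt (a * (w - a)) + t * (b - a) ≤ -Real.sqrt (b * (w - b)) := by
  obtain ⟨s, hs⟩ : ∃ s, s = Real.sqrt (1 + t ^ 2) - t := ⟨_, rfl⟩
  have hq : Real.sqrt (1 + t ^ 2) ^ 2 = 1 + t ^ 2 := Real.sq_sqrt (by positivity)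
  have hq' : Real.sqrt (1 + t ^ 2) = s + t := by linarith
  have hs0 : 0 < s := by
    have : t < Real.sqrt (1 + t ^ 2) := Real.lt_sqrt_of_sq_lt (by linarith)
    linarith
  rw [hq'] at hq
  have ht : s ^ 2 + 2 * s * t = 1 := by linarith
  have hg : gfun t = 1 + s ^ 2 := by
    unfold gfun
    rw [hq']
    linear_combination -ht
  rw [hg] at hwa
  have ha : 0 ≤ a := by
    by_contra hneg
    push Not at hneg
    have : a * (1 + s ^ 2) < 0 := mul_neg_of_neg_of_pos hneg (by positivity)
    linarith
  have h1 : Real.sqrt (a * (w - a)) = a * s := by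
    rw [show a * (w - a) = (a * s) ^ 2 by rw [hwa]; ring]
    exact Real.sqrt_sq (by positivity)
  refine ⟨ha, by nlinarith [mul_nonneg ha (sq_nonneg s)], ?_⟩
  rw [h1]
  have h2 : Real.sqrt (b * (w - b)) ≤ a * s + t * (a - b) := by
    have hkey : 2 * s * (a * s + t * (a - b)) = b * s ^ 2 + (w - b) := by
      rw [hwa]; linear_combination (a - b) * ht
    have hnn : 0 ≤ a * s + t * (a - b) := by
      have : 0 ≤ 2 * s * (a * s + t * (a - b)) := by
        rw [hkey]; have := mul_nonneg hb0 (sq_nonneg s); linarith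
      exact nonneg_of_mul_nonneg_right this (by positivity)
    apply Real.sqrt_le_iff.2 ⟨hnn, ?_⟩
    have h4 : 4 * s ^ 2 * (b * (w - b)) ≤ 4 * s ^ 2 * (a * s + t * (a - b)) ^ 2 := by
      have : 4 * s ^ 2 * (a * s + t * (a - b)) ^ 2 = (b * s ^ 2 + (w - b)) ^ 2 := by
        rw [← hkey]; ring
      rw [this]
      nlinarith [sq_nonneg (b * s ^ 2 - (w - b))]
    exact le_of_mul_le_mul_left h4 (by positivity)
  linarith

theorem level_null {n : ℕ} (hn : 2 ≤ n) (X : Set (Pt n)) (hX : IsCompact X)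
    (f k : Pt n → ℝ) (hf : DifferentiableOn ℝ f X) (hk : DifferentiableOn ℝ k X)
    (hne : ∀ x ∈ X, fderivWithin ℝ f X x ≠ fderivWithin ℝ k X x) (r : ℝ) :
    volume {x ∈ X | f x - k x = r} = 0 := by
  set S := {x ∈ X | f x - k x = r} with hS
  have hSX : S ⊆ X := fun x hx => hx.1
  have hSm : MeasurableSet S := by
    have : IsClosed (X ∩ (fun x => f x - k x) ⁻¹' {r}) :=
      (hf.continuousOn.sub hk.continuousOn).preimage_isClosed_of_isClosed hX.isClosed
        isClosed_singleton
    exact this.measurableSet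
  let e : Pt n := EuclideanSpace.single ⟨0, by omega⟩ 1
  have he : e ≠ 0 := by
    intro h0
    have := congrArg (fun v : Pt n => v ⟨0, by omega⟩) h0
    simp [e] at this
  let D : Pt n → (Pt n →L[ℝ] ℝ) := fun x => fderivWithin ℝ f X x - fderivWithin ℝ k X x
  have happ : ApproximatesLinearOn (fun x => (f x - k x) • e) (0 : Pt n →L[ℝ] Pt n) S 0 := by
    intro x hx y hy
    simp [hx.2, hy.2]
  have hder : ∀ x ∈ S, HasFDerivWithinAt (fun x => (f x - k x) • e) ((D x).smulRight e) S x := by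
    intro x hx
    have h1 := ((hf x hx.1).hasFDerivWithinAt.sub (hk x hx.1).hasFDerivWithinAt).mono hSX
    exact h1.smul_const e
  have := happ.norm_fderiv_sub_le volume hSm _ hder
  rw [ae_restrict_iff' hSm] at this
  refine measure_mono_null ?_ this
  intro x hx hcon
  have h0 := hcon hx
  have h1 : (D x).smulRight e = 0 := by
    have h3 : D x = 0 ∨ e = 0 := by simpa using h0
    have h4 : D x = 0 := h3.resolve_right he
    ext v
    simp [h4]
  apply hne x hx.1
  rw [← sub_eq_zero]
  ext v
  have h2 := congrArg (fun L : Pt n →L[ℝ] Pt n => L v) h1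
  simp only [ContinuousLinearMap.smulRight_apply, ContinuousLinearMap.zero_apply,
    smul_eq_zero, he, or_false] at h2
  exact h2

theorem sum_G {n N : ℕ} (hn : 2 ≤ n) (hN : 1 ≤ N)
    (X : Set (Pt n)) (hX : IsCompact X)
    (c : Pt n → Fin N → ℝ) (hreg : RegCond X c) (htw : TwistCond X c)
    (μ : Measure (Pt n)) (hprob : IsProbabilityMeasure μ)
    (hac : μ ≪ volume) (hsupp : μ Xᶜ = 0) (ψ : Fin N → ℝ) :
    ∑ i, Gfun X c μ ψ i = 1 := by
  haveI : Nonempty (Fin N) := ⟨⟨0, hN⟩⟩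
  have hd : ∀ i, DifferentiableOn ℝ (fun x => c x i) X :=
    fun i => (hreg i).differentiableOn (by norm_num)
  have hLag : ∀ i, LagCell X c ψ i = ⋂ j, {x ∈ X | c x i - c x j ≤ ψ j - ψ i} := by
    intro i
    ext x
    simp only [LagCell, mem_setOf_eq, mem_iInter]
    constructor
    · rintro ⟨hx, h⟩ j
      refine ⟨hx, ?_⟩
      have : -c x j - ψ j ≤ ⨆ j, (-c x j - ψ j) :=
        le_ciSup (f := fun j => -c x j - ψ j) (Set.finite_range _).bddAbove j
      linarith
    · intro h
      refine ⟨(h i).1, le_antisymm ?_ ?_⟩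
      · exact le_ciSup (f := fun j => -c x j - ψ j) (Set.finite_range _).bddAbove i
      · apply ciSup_le
        intro j
        have := (h j).2
        linarith
  have hm : ∀ i, MeasurableSet (LagCell X c ψ i) := by
    intro i
    rw [hLag]
    refine MeasurableSet.iInter fun j => ?_
    have : IsClosed (X ∩ (fun x => c x i - c x j) ⁻¹' Iic (ψ j - ψ i)) :=
      ((hd i).continuousOn.sub (hd j).continuousOn).preimage_isClosed_of_isClosed hX.isClosed
        isClosed_Iic
    exact this.measurableSet
  have hdisj : Pairwise (Function.onFun (AEDisjoint μ) (LagCell X c ψ)) := by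
    intro i j hij
    apply hac
    refine measure_mono_null ?_ (level_null hn X hX _ _ (hd i) (hd j)
      (fun x hx => htw x hx i j hij) (ψ j - ψ i))
    rintro x ⟨hi, hj⟩
    refine ⟨hi.1, ?_⟩
    have h1 := hi.2
    have h2 := hj.2
    linarith
  have hU : ⋃ i, LagCell X c ψ i = X := by
    apply subset_antisymm
    · exact iUnion_subset fun i x hx => hx.1
    · intro x hx
      obtain ⟨i, hi⟩ := exists_eq_ciSup_of_finite (f := fun j => -c x j - ψ j)
      exact mem_iUnion.2 ⟨i, hx, hi⟩
  have hX1 : μ X = 1 := (prob_compl_eq_zero_iff hX.measurableSet).1 hsupp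
  have h := measure_iUnion₀ hdisj (fun i => (hm i).nullMeasurableSet)
  rw [hU, hX1, tsum_fintype] at h
  unfold Gfun
  rw [← ENNReal.toReal_sum (fun i _ => measure_ne_top _ _), ← h]
  simp

theorem stmt8
    (n N : ℕ) (hn : 2 ≤ n) (hN : 1 ≤ N)
    (X : Set (Pt n)) (hX : IsCompact X)
    (Y : Fin N → Pt n) (hY : Function.Injective Y)
    (c : Pt n → Fin N → ℝ) (hreg : RegCond X c) (htw : TwistCond X c)
    (μ : Measure (Pt n)) (hprob : IsProbabilityMeasure μ)
    (hac : μ ≪ volume) (hsupp : μ Xᶜ = 0) :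
    ∀ (h ε : ℝ) (w ψ : Fin N → ℝ),
      0 < h → 0 < ε → (∀ i, 0 ≤ w i) → 1 ≤ ∑ i, w i →
      wmap X c μ h ε ψ = w →
      Fwhe w h ε (Gfun X c μ ψ) ≠ ⊤ ∧
      ∀ β : Fin N → ℝ,
        Fwhe w h ε (Gfun X c μ ψ) +
            ((∑ i, ψ i * (β i - Gfun X c μ ψ i) : ℝ) : EReal) ≤ Fwhe w h ε β := by
  intro h ε w ψ hh hε hw hw1 hwm
  have hwi : ∀ i, w i = (Gfun X c μ ψ i - ε) * gfun (ψ i / h) := fun i => by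
    rw [← hwm]; rfl
  have hG : Gfun X c μ ψ ∈ simplexSet N ∧ ∀ i, Gfun X c μ ψ i ∈ Icc ε (w i + ε) := by
    refine ⟨⟨sum_G hn hN X hX c hreg htw μ hprob hac hsupp ψ,
      fun i => ENNReal.toReal_nonneg⟩, fun i => ?_⟩
    obtain ⟨h1, h2, -⟩ := coord_ineq _ 0 _ _ (hw i) (hwi i) le_rfl (hw i)
    exact ⟨by linarith, by linarith⟩
  have hF : Fwhe w h ε (Gfun X c μ ψ) = _ := if_pos hG
  refine ⟨by rw [hF]; exact EReal.coe_ne_top _, fun β => ?_⟩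
  by_cases hβ : β ∈ simplexSet N ∧ ∀ i, β i ∈ Icc ε (w i + ε)
  · have hFβ : Fwhe w h ε β = _ := if_pos hβ
    rw [hF, hFβ, ← EReal.coe_add, EReal.coe_le_coe_iff, Finset.mul_sum, Finset.mul_sum,
      ← Finset.sum_add_distrib]
    refine Finset.sum_le_sum fun i _ => ?_
    obtain ⟨-, -, h3⟩ := coord_ineq _ (β i - ε) _ _ (hw i) (hwi i)
      (by linarith [(hβ.2 i).1]) (by linarith [(hβ.2 i).2])
    have h4 := mul_le_mul_of_nonneg_left h3 hh.le
    have h5 : h * (ψ i / h) = ψ i := by field_simp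
    rw [show w i - Gfun X c μ ψ i + ε = w i - (Gfun X c μ ψ i - ε) by ring,
      show w i - β i + ε = w i - (β i - ε) by ring]
    have h6 : ψ i * (β i - Gfun X c μ ψ i) =
        h * (ψ i / h * (β i - ε - (Gfun X c μ ψ i - ε))) := by
      rw [← mul_assoc, h5]; ring
    rw [h6]
    linarith
  · have hFβ : Fwhe w h ε β = ⊤ := if_neg hβ
    rw [hFβ]
    exact le_top
end
end

section
/- Let h > 0, t₀ > 0 and ε ∈ ℝ, and define f(t) = −h·√((t−ε)(t₀ − t + ε)) for t ∈ [ε, t₀ + ε]. Then f is differentiable on the open interval (ε, t₀ + ε) with f'(t) = h·(2(t−ε) − t₀) / (2√((t−ε)(t₀ − t + ε))). Moreover, for any t₁ ∈ ℝ and any t > ε, if t₀ = (t − ε)·g(t₁/h), then f'(t) = t₁. -/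
open MeasureTheory Metric Set Filter
open scoped Classical

noncomputable section

variable {n N : ℕ}

theorem stmt9 (h : ℝ) (hh : 0 < h) :
    (∀ (t₀ ε : ℝ), 0 < t₀ → ∀ t ∈ Set.Ioo ε (t₀ + ε),
      HasDerivAt (fun s => -h * Real.sqrt ((s - ε) * (t₀ - s + ε)))
        (h * (2 * (t - ε) - t₀) / (2 * Real.sqrt ((t - ε) * (t₀ - t + ε)))) t) ∧
    (∀ (t₀ ε t₁ t : ℝ), 0 < t₀ → ε < t → t₀ = (t - ε) * gfun (t₁ / h) →
      HasDerivAt (fun s => -h * Real.sqrt ((s - ε) * (t₀ - s + ε))) t₁ t) := by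
  have key : ∀ (t₀ ε : ℝ), 0 < t₀ → ∀ t ∈ Set.Ioo ε (t₀ + ε),
      HasDerivAt (fun s => -h * Real.sqrt ((s - ε) * (t₀ - s + ε)))
        (h * (2 * (t - ε) - t₀) / (2 * Real.sqrt ((t - ε) * (t₀ - t + ε)))) t := by
    intro t₀ ε _ t ht
    have hpos : 0 < (t - ε) * (t₀ - t + ε) :=
      mul_pos (by linarith [ht.1]) (by linarith [ht.2])
    have h1 : HasDerivAt (fun s : ℝ => s - ε) 1 t := (hasDerivAt_id t).sub_const ε
    have h2 : HasDerivAt (fun s : ℝ => t₀ - s + ε) (-1) t :=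
      ((hasDerivAt_id t).const_sub t₀).add_const ε
    have h3 := ((h1.fun_mul h2).sqrt hpos.ne').const_mul (-h)
    refine h3.congr_deriv ?_
    rw [mul_div_assoc', div_left_inj' (by positivity)]
    ring
  refine ⟨key, ?_⟩
  intro t₀ ε t₁ t h0 ht hg
  unfold gfun at hg
  obtain ⟨a, ha⟩ : ∃ a, a = t₁ / h := ⟨_, rfl⟩
  have ht1 : t₁ = h * a := by rw [ha]; field_simp
  rw [← ha] at hg
  obtain ⟨S, hS⟩ : ∃ S, S = Real.sqrt (1 + a ^ 2) := ⟨_, rfl⟩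
  rw [← hS] at hg
  have hS2 : S ^ 2 = 1 + a ^ 2 := by rw [hS]; exact Real.sq_sqrt (by positivity)
  have hS0 : 0 ≤ S := by rw [hS]; exact Real.sqrt_nonneg _
  have hd : 0 < S - a := by nlinarith
  have hu : 0 < t - ε := by linarith
  have e1 : t₀ - t + ε = (t - ε) * (S - a) ^ 2 := by
    rw [hg]; linear_combination (-(t - ε)) * hS2
  have hp : 0 < (t - ε) * (S - a) ^ 2 := by positivity
  have e2 : Real.sqrt ((t - ε) * (t₀ - t + ε)) = (t - ε) * (S - a) := by
    rw [e1, show (t - ε) * ((t - ε) * (S - a) ^ 2) = ((t - ε) * (S - a)) ^ 2 by ring]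
    exact Real.sqrt_sq (by positivity)
  have e3 : 2 * (t - ε) - t₀ = 2 * a * ((t - ε) * (S - a)) := by
    rw [hg]; ring
  have h4 := key t₀ ε h0 t ⟨ht, by linarith⟩
  rw [e2, e3] at h4
  refine h4.congr_deriv ?_
  rw [ht1]
  have : (t - ε) * (S - a) ≠ 0 := by positivity
  field_simp
end
end

section
/- Let h ∈ (0,1], ε ∈ (0,1/(2N)), and w ∈ ℝᴺ with wⁱ ∈ [0,1] for all i and Σ_i wⁱ ≥ 1. Then 𝒩_{w,h,ε} is nonempty and bounded. More precisely, every ψ ∈ 𝒩_{w,h,ε} satisfies, for every i, h·g^{-1}(2N) − (M₁ − m₁) ≤ ψⁱ ≤ h·g^{-1}(1/(1 − Nε)) + (M₁ − m₁), where m₁ := min_{X×Y} c, M₁ := max_{X×Y} c, and g^{-1} : (1,∞) → ℝ is the inverse of the strictly decreasing bijection g : ℝ → (1,∞). Moreover, there is a constant C > 0, depending only on n, N, α, X, Y, c and μ, such that diam(𝒩_{w,h,ε}) ≤ C·ε^{-1/2}. -/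
open MeasureTheory Metric Set Filter
open scoped Classical

noncomputable section

variable {n N : ℕ}

lemma aux_gfun_eq (t : ℝ) : gfun t = 1 + (Real.sqrt (1 + t ^ 2) - t) ^ 2 := by
  have h := Real.sq_sqrt (show (0:ℝ) ≤ 1 + t ^ 2 by positivity)
  unfold gfun
  nlinarith

lemma aux_u_pos (t : ℝ) : 0 < Real.sqrt (1 + t ^ 2) - t := by
  have : |t| < Real.sqrt (1 + t ^ 2) := by
    rw [← Real.sqrt_sq_eq_abs]
    exact Real.sqrt_lt_sqrt (by positivity) (by linarith)
  linarith [le_abs_self t]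

lemma aux_gfun_anti : StrictAnti gfun := by
  intro a b hab
  rw [aux_gfun_eq, aux_gfun_eq]
  have ha := aux_u_pos a
  have hb := aux_u_pos b
  have h1 := Real.sq_sqrt (show (0:ℝ) ≤ 1 + a ^ 2 by positivity)
  have h2 : Real.sqrt (1 + b ^ 2) < Real.sqrt (1 + a ^ 2) + (b - a) := by
    rw [Real.sqrt_lt' (by linarith [Real.sqrt_nonneg (1 + a ^ 2)])]
    nlinarith [mul_pos (sub_pos.2 hab) ha]
  have h3 : Real.sqrt (1 + b ^ 2) - b < Real.sqrt (1 + a ^ 2) - a := by linarith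
  have := pow_lt_pow_left₀ h3 hb.le (n := 2) (by norm_num)
  linarith

lemma aux_gfun_cont : Continuous gfun := by
  unfold gfun
  fun_prop

lemma aux_gfun_inv (s : ℝ) (hs : 1 < s) : gfun ((2 - s) / (2 * Real.sqrt (s - 1))) = s := by
  have hu : 0 < Real.sqrt (s - 1) := Real.sqrt_pos.2 (by linarith)
  have hsq := Real.sq_sqrt (show (0:ℝ) ≤ s - 1 by linarith)
  set u := Real.sqrt (s - 1) with hudef
  have hs' : s = 1 + u ^ 2 := by linarith
  rw [aux_gfun_eq]
  have h1 : 1 + ((2 - s) / (2 * u)) ^ 2 = ((1 + u ^ 2) / (2 * u)) ^ 2 := by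
    rw [hs']; field_simp; ring
  rw [h1, Real.sqrt_sq (by positivity), hs']
  field_simp
  ring

lemma aux_invFun (s : ℝ) (hs : 1 < s) :
    Function.invFun gfun s = (2 - s) / (2 * Real.sqrt (s - 1)) := by
  conv_lhs => rw [← aux_gfun_inv s hs]
  exact Function.leftInverse_invFun aux_gfun_anti.injective _

lemma aux_exists {N : ℕ} (hN : 1 ≤ N) (G : (Fin N → ℝ) → Fin N → ℝ) (D : ℝ) (hD : 0 ≤ D)
    (hcont : ∀ i, Continuous fun ψ => G ψ i)
    (hsum : ∀ ψ, ∑ i, G ψ i = 1)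
    (hnn : ∀ ψ i, 0 ≤ G ψ i)
    (hdiff : ∀ ψ i, 0 < G ψ i → ∀ j, ψ i - ψ j ≤ D)
    (hmono : ∀ ψ i δ, 0 ≤ δ → ∀ j, j ≠ i → G (Function.update ψ i (ψ i - δ)) j ≤ G ψ j) :
    ∃ ψ, ∀ i, G ψ i = 1 / N := by
  have hNpos : (0:ℝ) < N := by exact_mod_cast hN
  let z : Fin N := ⟨0, hN⟩
  let K : ℝ := D + 1
  let A : Set (Fin N → ℝ) :=
    (Set.univ.pi fun _ => Icc (-K) K) ∩ ({ψ | ψ z = 0} ∩ ⋂ i, {ψ | i ≠ z → G ψ i ≤ 1 / N})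
  have hAc : IsCompact A := by
    refine (isCompact_univ_pi fun _ => isCompact_Icc).inter_right ?_
    refine (isClosed_eq (continuous_apply z) continuous_const).inter ?_
    refine isClosed_iInter fun i => ?_
    by_cases hi : i = z
    · simp [hi]
    · simpa [hi] using isClosed_le (hcont i) continuous_const
  have hAne : A.Nonempty := by
    refine ⟨fun i => if i = z then 0 else K, ?_, by simp, ?_⟩
    · intro i _
      dsimp only
      split_ifs <;> constructor <;> simp only [K] <;> linarith
    · rw [mem_iInter]
      intro i hi
      by_contra hlt
      have hpos : 0 < G (fun i => if i = z then 0 else K) i :=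
        lt_trans (by positivity) (not_le.1 hlt)
      have := hdiff _ i hpos z
      simp [hi, K] at this
      linarith
  obtain ⟨ψ, hψA, hmin⟩ := hAc.exists_isMinOn hAne
    (f := fun ψ => ∑ i, ψ i) (by fun_prop)
  obtain ⟨hbox, hz, hle⟩ := hψA
  rw [mem_iInter] at hle
  have hz' : ψ z = 0 := hz
  have key : ∀ i, i ≠ z → G ψ i = 1 / N := by
    intro i hi
    refine le_antisymm (hle i hi) ?_
    by_contra hlt
    rw [not_le] at hlt
    have hgt : -K < ψ i := by
      rcases lt_or_eq_of_le (hbox i trivial).1 with h | h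
      · exact h
      · exfalso
        have hGz : G ψ z = 0 := by
          by_contra hne
          have := hdiff ψ z (lt_of_le_of_ne (hnn _ _) (Ne.symm hne)) i
          rw [← h, hz'] at this
          simp only [K] at this
          linarith
        have h1 : ∑ j, G ψ j < ∑ j : Fin N, 1 / (N:ℝ) := by
          refine Finset.sum_lt_sum (fun j _ => ?_) ⟨i, Finset.mem_univ _, hlt⟩
          by_cases hj : j = z
          · rw [hj, hGz]; positivity
          · exact hle j hj
        rw [hsum] at h1
        simp at h1
        rw [mul_inv_cancel₀ hNpos.ne'] at h1
        exact lt_irrefl _ h1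
    have hc : Continuous fun δ : ℝ => G (Function.update ψ i (ψ i - δ)) i :=
      (hcont i).comp (continuous_const.update i (by fun_prop))
    have hev : ∀ᶠ δ in nhds (0:ℝ), G (Function.update ψ i (ψ i - δ)) i < 1 / N := by
      have : G (Function.update ψ i (ψ i - 0)) i < 1 / N := by simpa using hlt
      exact hc.continuousAt.eventually (gt_mem_nhds this)
    have hev2 : ∀ᶠ δ in nhds (0:ℝ), δ < ψ i + K := gt_mem_nhds (by linarith)
    obtain ⟨δ, ⟨h1, h2⟩, h3⟩ := (((hev.and hev2).filter_mono nhdsWithin_le_nhds).and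
      (self_mem_nhdsWithin : Ioi (0:ℝ) ∈ nhdsWithin 0 (Ioi 0))).exists
    have h3' : 0 < δ := h3
    have hmem : Function.update ψ i (ψ i - δ) ∈ A := by
      refine ⟨?_, ?_, ?_⟩
      · intro j _
        by_cases hj : j = i
        · subst hj
          have := (hbox j trivial).2
          simp only [Function.update_self]
          constructor <;> linarith
        · simpa [hj] using hbox j trivial
      · simpa [Ne.symm hi] using hz'
      · rw [mem_iInter]
        intro j hj
        by_cases hji : j = i
        · subst hji; exact h1.le
        · exact (hmono ψ i δ h3'.le j hji).trans (hle j hj)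
    have := isMinOn_iff.1 hmin _ hmem
    have hs : ∑ j, Function.update ψ i (ψ i - δ) j < ∑ j, ψ j := by
      refine Finset.sum_lt_sum (fun j _ => ?_) ⟨i, Finset.mem_univ _, by simpa using h3'⟩
      by_cases hj : j = i
      · subst hj; simpa using h3'.le
      · simp [hj]
    linarith
  refine ⟨ψ, fun i => ?_⟩
  by_cases hi : i = z
  · have h1 : ∑ j, (G ψ j - 1 / N) = 0 := by
      rw [Finset.sum_sub_distrib, hsum]
      simp
      rw [mul_inv_cancel₀ hNpos.ne', sub_self]
    rw [Finset.sum_eq_single z (fun j _ hj => by rw [key j hj, sub_self]) (by simp)] at h1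
    rw [hi]; linarith
  · exact key i hi

lemma aux_mem_Lag (X : Set (Pt n)) (c : Pt n → Fin N → ℝ) (ψ : Fin N → ℝ) (i : Fin N)
    (x : Pt n) : x ∈ LagCell X c ψ i ↔ x ∈ X ∧ ∀ j, -c x j - ψ j ≤ -c x i - ψ i := by
  unfold LagCell
  have : Nonempty (Fin N) := ⟨i⟩
  have hb : BddAbove (range fun j => -c x j - ψ j) := (finite_range _).bddAbove
  constructor
  · rintro ⟨hx, h⟩
    exact ⟨hx, fun j => h ▸ le_ciSup hb j⟩
  · rintro ⟨hx, h⟩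
    exact ⟨hx, le_antisymm (le_ciSup hb i) (ciSup_le h)⟩

lemma aux_Lag_closed {X : Set (Pt n)} (hX : IsCompact X) {c : Pt n → Fin N → ℝ}
    (hreg : RegCond X c) (ψ : Fin N → ℝ) (i : Fin N) : IsClosed (LagCell X c ψ i) := by
  have : LagCell X c ψ i = X ∩ ⋂ j, {x ∈ X | -c x j - ψ j ≤ -c x i - ψ i} := by
    ext x
    rw [aux_mem_Lag]
    simp only [mem_inter_iff, mem_iInter, mem_setOf_eq]
    exact ⟨fun h => ⟨h.1, fun j => ⟨h.1, h.2 j⟩⟩, fun h => ⟨h.1, fun j => (h.2 j).2⟩⟩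
  rw [this]
  refine hX.isClosed.inter (isClosed_iInter fun j => ?_)
  have hi := (hreg i).continuousOn
  have hj := (hreg j).continuousOn
  exact hX.isClosed.isClosed_le (hj.neg.sub continuousOn_const) (hi.neg.sub continuousOn_const)

lemma aux_level_null (hn : 2 ≤ n) {X : Set (Pt n)} (hX : IsCompact X) {c : Pt n → Fin N → ℝ}
    (hreg : RegCond X c) (htw : TwistCond X c) {i k : Fin N} (hik : i ≠ k) (t : ℝ) :
    volume {x ∈ X | c x i - c x k = t} = 0 := by
  set S := {x ∈ X | c x i - c x k = t} with hS
  have hi := (hreg i).continuousOn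
  have hk := (hreg k).continuousOn
  have hclosed : IsClosed S := by
    have := (hi.sub hk).preimage_isClosed_of_isClosed hX.isClosed (isClosed_singleton (x := t))
    exact this
  let e : Pt n := EuclideanSpace.single ⟨0, by omega⟩ 1
  have he : e ≠ 0 := by
    intro h
    have := congrArg (fun v : Pt n => v ⟨0, by omega⟩) h
    simp [e] at this
  let f : Pt n → Pt n := fun x => (c x i - c x k) • e
  let f' : Pt n → Pt n →L[ℝ] Pt n := fun x =>
    (fderivWithin ℝ (fun y => c y i) X x - fderivWithin ℝ (fun y => c y k) X x).smulRight e
  have hf' : ∀ x ∈ S, HasFDerivWithinAt f (f' x) S x := by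
    intro x hx
    have h1 := (((hreg i).differentiableOn (by norm_num)) x hx.1).hasFDerivWithinAt
    have h2 := (((hreg k).differentiableOn (by norm_num)) x hx.1).hasFDerivWithinAt
    exact ((h1.sub h2).smul_const e).mono (fun y hy => hy.1)
  have hf : ApproximatesLinearOn f (0 : Pt n →L[ℝ] Pt n) S 0 := by
    intro x hx y hy
    have hx2 : c x i - c x k = t := hx.2
    have hy2 : c y i - c y k = t := hy.2
    simp [f, hx2, hy2]
  have h := hf.norm_fderiv_sub_le volume hclosed.measurableSet f' hf'
  rw [ae_restrict_iff' hclosed.measurableSet] at h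
  have h2 : ∀ᵐ x ∂(volume : Measure (Pt n)), x ∉ S := by
    filter_upwards [h] with x hx hxS
    have h0 := hx hxS
    rw [sub_zero, nonpos_iff_eq_zero, nnnorm_eq_zero] at h0
    apply htw x hxS.1 i k hik
    rw [← sub_eq_zero]
    ext v
    have := congrArg (fun L : Pt n →L[ℝ] Pt n => L v) h0
    simpa [f', he] using this
  rw [ae_iff] at h2
  simpa using h2

lemma aux_ae_ne (hn : 2 ≤ n) {X : Set (Pt n)} (hX : IsCompact X) {c : Pt n → Fin N → ℝ}
    (hreg : RegCond X c) (htw : TwistCond X c) {μ : Measure (Pt n)} (hac : μ ≪ volume)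
    (hsupp : μ Xᶜ = 0) (ψ : Fin N → ℝ) :
    ∀ᵐ x ∂μ, x ∈ X ∧ ∀ i k, i ≠ k → -c x i - ψ i ≠ -c x k - ψ k := by
  have h1 : ∀ᵐ x ∂μ, x ∈ X := by rw [ae_iff]; exact hsupp
  have h2 : ∀ i k : Fin N, i ≠ k → ∀ᵐ x ∂μ, ¬ (x ∈ X ∧ c x i - c x k = ψ k - ψ i) := by
    intro i k hik
    rw [ae_iff]
    simp only [not_not]
    exact hac (aux_level_null hn hX hreg htw hik _)
  have h3 : ∀ᵐ x ∂μ, ∀ i k : Fin N, i ≠ k → ¬ (x ∈ X ∧ c x i - c x k = ψ k - ψ i) := by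
    rw [ae_all_iff]; intro i
    rw [ae_all_iff]; intro k
    by_cases hik : i = k
    · simp [hik]
    · filter_upwards [h2 i k hik] with x hx _ using hx
  filter_upwards [h1, h3] with x hx1 hx3
  exact ⟨hx1, fun i k hik heq => hx3 i k hik ⟨hx1, by linarith⟩⟩

lemma aux_G_sum (hn : 2 ≤ n) (hN : 1 ≤ N) {X : Set (Pt n)} (hX : IsCompact X)
    {c : Pt n → Fin N → ℝ}
    (hreg : RegCond X c) (htw : TwistCond X c) {μ : Measure (Pt n)} [IsProbabilityMeasure μ]
    (hac : μ ≪ volume) (hsupp : μ Xᶜ = 0) (ψ : Fin N → ℝ) :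
    ∑ i, Gfun X c μ ψ i = 1 := by
  have : Nonempty (Fin N) := ⟨⟨0, hN⟩⟩
  have hne := aux_ae_ne hn hX hreg htw hac hsupp ψ
  have hd : Pairwise (Function.onFun (AEDisjoint μ) (LagCell X c ψ)) := by
    intro i k hik
    have : ∀ᵐ x ∂μ, x ∉ LagCell X c ψ i ∩ LagCell X c ψ k := by
      filter_upwards [hne] with x hx hmem
      have h1 := ((aux_mem_Lag _ _ _ _ _).1 hmem.1).2 k
      have h2 := ((aux_mem_Lag _ _ _ _ _).1 hmem.2).2 i
      exact hx.2 i k hik (le_antisymm h2 h1)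
    rw [ae_iff] at this
    simpa [Function.onFun, AEDisjoint] using this
  have h1 := measure_iUnion₀ hd
    (fun i => (aux_Lag_closed hX hreg ψ i).measurableSet.nullMeasurableSet)
  have h2 : μ (⋃ i, LagCell X c ψ i) = 1 := by
    rw [← prob_compl_eq_zero_iff₀
      (NullMeasurableSet.iUnion
        (fun i => (aux_Lag_closed hX hreg ψ i).measurableSet.nullMeasurableSet))]
    refine measure_mono_null ?_ hsupp
    intro x hx hxX
    apply hx
    obtain ⟨i, hi⟩ := Finite.exists_max fun i => -c x i - ψ i
    exact mem_iUnion.2 ⟨i, (aux_mem_Lag _ _ _ _ _).2 ⟨hxX, hi⟩⟩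
  rw [h2, tsum_fintype] at h1
  unfold Gfun
  rw [← ENNReal.toReal_sum (fun i _ => measure_ne_top _ _), ← h1]
  simp

lemma aux_G_cont (hn : 2 ≤ n) {X : Set (Pt n)} (hX : IsCompact X)
    {c : Pt n → Fin N → ℝ}
    (hreg : RegCond X c) (htw : TwistCond X c) {μ : Measure (Pt n)} [IsProbabilityMeasure μ]
    (hac : μ ≪ volume) (hsupp : μ Xᶜ = 0) (i : Fin N) :
    Continuous fun ψ => Gfun X c μ ψ i := by
  rw [continuous_iff_continuousAt]
  intro ψ
  unfold Gfun
  refine (ENNReal.tendsto_toReal (measure_ne_top _ _)).comp ?_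
  refine tendsto_measure_of_ae_tendsto_indicator_of_isFiniteMeasure (nhds ψ)
    (aux_Lag_closed hX hreg ψ i).measurableSet
    (fun φ => (aux_Lag_closed hX hreg φ i).measurableSet) ?_
  filter_upwards [aux_ae_ne hn hX hreg htw hac hsupp ψ] with x hx
  simp only [aux_mem_Lag, hx.1, true_and]
  have hc : ∀ j, Continuous fun φ : Fin N → ℝ => -c x j - φ j := fun j => by fun_prop
  by_cases hall : ∀ j, -c x j - ψ j ≤ -c x i - ψ i
  · have : ∀ j, ∀ᶠ φ in nhds ψ, -c x j - φ j ≤ -c x i - φ i := by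
      intro j
      by_cases hj : j = i
      · subst hj; simp
      · have hlt : -c x j - ψ j < -c x i - ψ i := lt_of_le_of_ne (hall j) (hx.2 j i hj)
        filter_upwards [((hc j).continuousAt.eventually_lt (hc i).continuousAt hlt)] with φ hφ
        exact hφ.le
    filter_upwards [eventually_all.2 this] with φ hφ
    exact ⟨fun _ => hall, fun _ => hφ⟩
  · have hall' := hall
    push Not at hall'
    obtain ⟨j, hj⟩ := hall'
    filter_upwards [((hc i).continuousAt.eventually_lt (hc j).continuousAt hj)] with φ hφ
    exact ⟨fun h => absurd (h j) (not_le.2 hφ), fun h => absurd h hall⟩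



theorem stmt10
    (n N : ℕ) (hn : 2 ≤ n) (hN : 1 ≤ N)
    (X : Set (Pt n)) (hX : IsCompact X)
    (Y : Fin N → Pt n) (hY : Function.Injective Y)
    (c : Pt n → Fin N → ℝ) (hreg : RegCond X c) (htw : TwistCond X c)
    (μ : Measure (Pt n)) (hprob : IsProbabilityMeasure μ)
    (hac : μ ≪ volume) (hsupp : μ Xᶜ = 0)
    (hqc : LoeperCond X c)
    (α : ℝ) (hα : 0 < α) (hα1 : α ≤ 1)
    (hdens : HolderDensity X μ α) :
    ∃ C > (0:ℝ), ∀ (h ε : ℝ) (w : Fin N → ℝ),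
      0 < h → h ≤ 1 → 0 < ε → ε < 1 / (2 * N) →
      (∀ i, w i ∈ Icc (0:ℝ) 1) → 1 ≤ ∑ i, w i →
      ∀ m₁ M₁ : ℝ, m₁ = sInf {r : ℝ | ∃ x ∈ X, ∃ i, c x i = r} →
        M₁ = sSup {r : ℝ | ∃ x ∈ X, ∃ i, c x i = r} →
      (Nset X c μ h ε w).Nonempty ∧ Bornology.IsBounded (Nset X c μ h ε w) ∧
      (∀ ψ ∈ Nset X c μ h ε w, ∀ i,
        h * Function.invFun gfun (2 * N) - (M₁ - m₁) ≤ ψ i ∧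
        ψ i ≤ h * Function.invFun gfun (1 / (1 - N * ε)) + (M₁ - m₁)) ∧
      Metric.diam (Nset X c μ h ε w) ≤ C * ε ^ (-(1:ℝ) / 2) := by
  have hNpos : (0:ℝ) < N := by exact_mod_cast hN
  have hN1 : (1:ℝ) ≤ N := by exact_mod_cast hN
  set V : Set ℝ := {r : ℝ | ∃ x ∈ X, ∃ i, c x i = r} with hV
  have hVc : IsCompact V := by
    have : V = ⋃ i, (fun x => c x i) '' X := by
      ext r; simp only [hV, mem_setOf_eq, mem_iUnion, mem_image]
      constructor
      · rintro ⟨x, hx, i, h⟩; exact ⟨i, x, hx, h⟩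
      · rintro ⟨i, x, hx, h⟩; exact ⟨x, hx, i, h⟩
    rw [this]
    exact isCompact_iUnion fun i => hX.image_of_continuousOn (hreg i).continuousOn
  have hcb : ∀ x ∈ X, ∀ i, sInf V ≤ c x i ∧ c x i ≤ sSup V := fun x hx i =>
    ⟨csInf_le hVc.bddBelow ⟨x, hx, i, rfl⟩, le_csSup hVc.bddAbove ⟨x, hx, i, rfl⟩⟩
  set D : ℝ := sSup V - sInf V with hDdef
  have hXne : X.Nonempty := by
    by_contra hne
    rw [not_nonempty_iff_eq_empty] at hne
    rw [hne] at hsupp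
    simp at hsupp
  have hD : 0 ≤ D := by
    obtain ⟨x, hx⟩ := hXne
    have := hcb x hx ⟨0, hN⟩
    linarith [this.1, this.2]
  have hGcont := aux_G_cont hn hX hreg htw hac hsupp
  have hGsum := aux_G_sum hn hN hX hreg htw hac hsupp
  have hdiff : ∀ ψ i, 0 < Gfun X c μ ψ i → ∀ j, ψ i - ψ j ≤ D := by
    intro ψ i hpos j
    have hne : (LagCell X c ψ i).Nonempty := by
      by_contra hne
      rw [not_nonempty_iff_eq_empty] at hne
      simp [Gfun, hne] at hpos
    obtain ⟨x, hx⟩ := hne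
    rw [aux_mem_Lag] at hx
    have h1 := hx.2 j
    have h2 := (hcb x hx.1 j).2
    have h3 := (hcb x hx.1 i).1
    linarith
  obtain ⟨ψ₀, hψ₀⟩ := aux_exists hN (Gfun X c μ) D hD hGcont hGsum
    (fun ψ i => ENNReal.toReal_nonneg) hdiff (by
      intro ψ i δ hδ j hj
      refine ENNReal.toReal_mono (measure_ne_top _ _) (measure_mono fun x hx => ?_)
      rw [aux_mem_Lag] at hx ⊢
      refine ⟨hx.1, fun k => ?_⟩
      have := hx.2 k
      by_cases hk : k = i
      · subst hk; simp [hj] at this; linarith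
      · simpa [hj, hk] using this)
  have hshift : ∀ r i, Gfun X c μ (fun j => ψ₀ j + r) i = 1 / N := by
    intro r i
    rw [← hψ₀ i]
    unfold Gfun
    congr 2
    ext x
    simp only [aux_mem_Lag]
    refine and_congr_right fun _ => forall_congr' fun j => ?_
    constructor <;> intro h <;> linarith
  refine ⟨1 + N + 2 * D, by positivity, ?_⟩
  intro h ε w hh hh1 hε hε2 hw hw1 m₁ M₁ hm hM
  subst hm hM
  have hNε : N * ε < 1 / 2 := by
    rw [lt_div_iff₀ (by positivity)] at hε2
    linarith
  have hNε0 : 0 < N * ε := by positivity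
  have hw2 : ∑ i, w i ≤ N := by
    calc ∑ i, w i ≤ ∑ i : Fin N, (1:ℝ) := Finset.sum_le_sum fun i _ => (hw i).2
      _ = N := by simp
  have hs1 : 1 < 1 / (1 - N * ε) := by rw [lt_div_iff₀ (by linarith)]; linarith
  have hs2 : 1 / (1 - N * ε) < 2 := by rw [div_lt_iff₀ (by linarith)]; linarith
  have h2N : (1:ℝ) < 2 * N := by linarith
  rw [aux_invFun _ hs1, aux_invFun _ h2N]
  have hgT := aux_gfun_inv _ hs1
  have hgL := aux_gfun_inv _ h2N
  have hTle : (2 - 1 / (1 - N * ε)) / (2 * Real.sqrt (1 / (1 - N * ε) - 1)) ≤ ε ^ (-(1:ℝ) / 2) := by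
    have h1 : ε ≤ 1 / (1 - N * ε) - 1 := by
      have : N * ε ≤ 1 / (1 - N * ε) - 1 := by
        rw [le_sub_iff_add_le, le_div_iff₀ (by linarith)]
        nlinarith
      nlinarith
    have h2 : ε ^ (-(1:ℝ) / 2) = 1 / Real.sqrt ε := by
      rw [neg_div, Real.rpow_neg hε.le, ← Real.sqrt_eq_rpow, one_div]
    rw [h2]
    have h3 : 0 < Real.sqrt ε := Real.sqrt_pos.2 hε
    have h4 := Real.sqrt_le_sqrt h1
    apply div_le_div₀ <;> linarith
  have hLge : -(N:ℝ) ≤ (2 - 2 * N) / (2 * Real.sqrt (2 * N - 1)) := by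
    have h1 : 1 ≤ Real.sqrt (2 * N - 1) := by
      rw [Real.one_le_sqrt]; linarith
    rw [le_div_iff₀ (by linarith)]
    nlinarith
  have hE1 : 1 ≤ ε ^ (-(1:ℝ) / 2) :=
    Real.one_le_rpow_of_pos_of_le_one_of_nonpos hε (by nlinarith) (by norm_num)
  set T := (2 - 1 / (1 - N * ε)) / (2 * Real.sqrt (1 / (1 - N * ε) - 1)) with hT
  set L := (2 - 2 * (N:ℝ)) / (2 * Real.sqrt (2 * N - 1)) with hL
  have hbounds : ∀ ψ ∈ Nset X c μ h ε w, ∀ i,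
        h * L - D ≤ ψ i ∧ ψ i ≤ h * T + D := by
    rintro ψ ⟨hK, hsum⟩ i
    have hS : ∑ i, (Gfun X c μ ψ i - ε) = 1 - N * ε := by
      rw [Finset.sum_sub_distrib, hGsum]; simp
    have hd : ∀ i j, ψ i - ψ j ≤ D := fun i j => hdiff ψ i (hε.trans (hK i)) j
    have hne : (Finset.univ : Finset (Fin N)).Nonempty := ⟨i, Finset.mem_univ _⟩
    constructor
    · obtain ⟨j, hj⟩ : ∃ j, h * L ≤ ψ j := by
        by_contra hcon
        push Not at hcon
        have : ∑ i, (Gfun X c μ ψ i - ε) * (2 * N) < ∑ i, wmap X c μ h ε ψ i := by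
          refine Finset.sum_lt_sum_of_nonempty hne fun j _ => ?_
          refine mul_lt_mul_of_pos_left ?_ (sub_pos.2 (hK j))
          rw [← hgL]
          apply aux_gfun_anti
          rw [div_lt_iff₀ hh]; linarith [hcon j]
        rw [← Finset.sum_mul, hS, ← hsum] at this
        nlinarith
      linarith [hd j i]
    · obtain ⟨j, hj⟩ : ∃ j, ψ j ≤ h * T := by
        by_contra hcon
        push Not at hcon
        have : ∑ i, wmap X c μ h ε ψ i < ∑ i, (Gfun X c μ ψ i - ε) * (1 / (1 - N * ε)) := by
          refine Finset.sum_lt_sum_of_nonempty hne fun j _ => ?_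
          refine mul_lt_mul_of_pos_left ?_ (sub_pos.2 (hK j))
          rw [← hgT]
          apply aux_gfun_anti
          rw [lt_div_iff₀ hh]; linarith [hcon j]
        rw [← Finset.sum_mul, hS, ← hsum, mul_one_div_cancel (by linarith)] at this
        linarith
      linarith [hd i j]
  have hbdd : Bornology.IsBounded (Nset X c μ h ε w) := by
    refine (Metric.isBounded_Icc (fun _ => h * L - D) (fun _ => h * T + D)).subset ?_
    exact fun ψ hψ => ⟨fun i => (hbounds ψ hψ i).1, fun i => (hbounds ψ hψ i).2⟩
  refine ⟨?_, hbdd, hbounds, ?_⟩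
  · have hεN : ε < 1 / N := by
      rw [lt_div_iff₀ hNpos]; linarith
    let F : ℝ → ℝ := fun r => ∑ i, wmap X c μ h ε (fun j => ψ₀ j + r) i
    have hF : F = fun r => ∑ i : Fin N, (1 / (N:ℝ) - ε) * gfun ((ψ₀ i + r) / h) := by
      funext r
      simp only [F, wmap, hshift]
    have hFc : Continuous F := by
      rw [hF]
      refine continuous_finset_sum _ fun i _ => continuous_const.mul (aux_gfun_cont.comp ?_)
      fun_prop
    have hsc : ∀ a : ℝ, ∑ i : Fin N, (1 / (N:ℝ) - ε) * a = (1 - N * ε) * a := by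
      intro a
      simp only [Finset.sum_const, Finset.card_univ, Fintype.card_fin, nsmul_eq_mul]
      field_simp
    let B : ℝ := ∑ i, |ψ₀ i|
    have hB : ∀ i, |ψ₀ i| ≤ B := fun i =>
      Finset.single_le_sum (f := fun i => |ψ₀ i|) (fun j _ => abs_nonneg _) (Finset.mem_univ i)
    have hup : F (h * T + B) ≤ ∑ i, w i := by
      refine le_trans ?_ hw1
      rw [hF]
      calc _ ≤ ∑ i : Fin N, (1 / (N:ℝ) - ε) * (1 / (1 - N * ε)) := by
            refine Finset.sum_le_sum fun i _ => mul_le_mul_of_nonneg_left ?_ (by linarith)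
            rw [← hgT]
            apply aux_gfun_anti.antitone
            rw [le_div_iff₀ hh]
            linarith [neg_le_of_abs_le (hB i)]
        _ = 1 := by rw [hsc, mul_one_div_cancel (by linarith)]
    have hlo : ∑ i, w i ≤ F (h * L - B) := by
      refine hw2.trans ?_
      rw [hF]
      calc (N:ℝ) ≤ (1 - N * ε) * (2 * N) := by nlinarith
        _ = ∑ i : Fin N, (1 / (N:ℝ) - ε) * (2 * N) := (hsc _).symm
        _ ≤ _ := by
            refine Finset.sum_le_sum fun i _ => mul_le_mul_of_nonneg_left ?_ (by linarith)
            rw [← hgL]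
            apply aux_gfun_anti.antitone
            rw [div_le_iff₀ hh]
            linarith [le_of_abs_le (hB i)]
    obtain ⟨r, hr⟩ := mem_range_of_exists_le_of_exists_ge hFc ⟨_, hup⟩ ⟨_, hlo⟩
    refine ⟨fun j => ψ₀ j + r, fun i => ?_, hr.symm⟩
    rw [hshift]; exact hεN
  · refine Metric.diam_le_of_forall_dist_le (by positivity) fun a ha b hb => ?_
    have hmain : h * T + D - (h * L - D) ≤ (1 + N + 2 * D) * ε ^ (-(1:ℝ) / 2) := by
      set E := ε ^ (-(1:ℝ) / 2)
      have h1 : h * (T - L) ≤ 1 * (E + N) :=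
        mul_le_mul hh1 (by linarith) (by
          have hT0 : 0 ≤ T := div_nonneg (by linarith) (by positivity)
          have hL0 : L ≤ 0 := div_nonpos_of_nonpos_of_nonneg (by linarith) (by positivity)
          linarith) zero_le_one
      nlinarith
    refine (dist_pi_le_iff (by positivity)).2 fun i => ?_
    rw [Real.dist_eq, abs_le]
    have h1 := hbounds a ha i
    have h2 := hbounds b hb i
    constructor <;> linarith [h1.1, h1.2, h2.1, h2.2]
end
end
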